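/- Any subclass C° of the complete pin class satisfies C_n ≤ 12·C_{n−1} for all n ≥ 1, where C_n is the number of elements of C° of length n. -/

import Mathlib

/-- A *centred permutation*: `vals` is the one-line notation of the filled-in
permutation (length `n+1`), `origin` the index of the origin point. -/
structure CPerm where
  vals : List ℕ
  origin : ℕ
deriving DecidableEq

namespace CPerm

/-- Length of a centred permutation (origin does not count). -/
def len (p : CPerm) : ℕ := p.vals.length - 1

/-- A genuine centred permutation: one-line notation is a permutation of
`{0, …, N-1}` and the origin index is in range. -/
def IsValid (p : CPerm) : Prop :=
  p.vals ≠ [] ∧ p.origin < p.vals.length ∧ p.vals.Perm (List.range p.vals.length)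

def valAt (p : CPerm) (i : ℕ) : ℕ := p.vals.getD i 0

def originVal (p : CPerm) : ℕ := p.valAt p.origin

/-- The box-sum `p ⊞ q`: inflate the origin of `q` by a copy of `p`. -/
def boxSum (p q : CPerm) : CPerm :=
  let N := p.vals.length
  let v := q.originVal
  let shift : ℕ → ℕ := fun u => if u < v then u else u + (N - 1)
  ⟨(q.vals.take q.origin).map shift ++ p.vals.map (· + v) ++
      (q.vals.drop (q.origin + 1)).map shift,
    q.origin + p.origin⟩

/-- The trivial centred permutation (origin only, length 0). -/
def trivial : CPerm := ⟨[0], 0⟩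

/-- Iterated box-sum `σ₁ ⊞ σ₂ ⊞ ⋯ ⊞ σₙ`. -/
def boxSumList (l : List CPerm) : CPerm := l.foldr boxSum trivial

/-- `p` is ⊞-indecomposable: nonempty and not a box-sum of two strictly smaller
centred permutations. -/
def BoxIndecomposable (p : CPerm) : Prop :=
  1 ≤ p.len ∧
    ¬∃ a b : CPerm, a.IsValid ∧ b.IsValid ∧ 1 ≤ a.len ∧ 1 ≤ b.len ∧ boxSum a b = p

/-- The non-origin point at index `i` of `p` lies in quadrant `q` (1–4,
numbered anticlockwise). -/
def InQuadrant (p : CPerm) (q : ℕ) (i : ℕ) : Prop :=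
  i < p.vals.length ∧ i ≠ p.origin ∧
    ((q = 1 ∧ p.origin < i ∧ p.originVal < p.valAt i) ∨
     (q = 2 ∧ i < p.origin ∧ p.originVal < p.valAt i) ∨
     (q = 3 ∧ i < p.origin ∧ p.valAt i < p.originVal) ∨
     (q = 4 ∧ p.origin < i ∧ p.valAt i < p.originVal))

/-- All non-origin points of `p` lie in quadrant `q`. -/
def OneQuadrant (p : CPerm) (q : ℕ) : Prop :=
  ∀ i, i < p.vals.length → i ≠ p.origin → InQuadrant p q i

def OppositeQuadrants (q₁ q₂ : ℕ) : Prop :=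
  (q₁ = 1 ∧ q₂ = 3) ∨ (q₁ = 3 ∧ q₂ = 1) ∨ (q₁ = 2 ∧ q₂ = 4) ∨ (q₁ = 4 ∧ q₂ = 2)

/-- Centred pattern containment `p ≤ q` (origins must match up). -/
def PatternLE (p q : CPerm) : Prop :=
  ∃ f : ℕ → ℕ,
    (∀ i j, i < p.vals.length → j < p.vals.length → i < j → f i < f j) ∧
    (∀ i, i < p.vals.length → f i < q.vals.length) ∧
    f p.origin = q.origin ∧
    (∀ i j, i < p.vals.length → j < p.vals.length →
      (p.valAt i < p.valAt j ↔ q.valAt (f i) < q.valAt (f j)))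

/-- A centred permutation class: nonempty, consisting of valid centred
permutations, and downward closed under centred containment. -/
def IsClass (S : Set CPerm) : Prop :=
  S.Nonempty ∧ (∀ p ∈ S, p.IsValid) ∧
    ∀ p q : CPerm, q ∈ S → p.IsValid → PatternLE p q → p ∈ S

/-- `S` is closed under the box-sum. -/
def BoxClosed (S : Set CPerm) : Prop := ∀ p ∈ S, ∀ q ∈ S, boxSum p q ∈ S

/-- Number of centred permutations of length `n` in `S`. -/
noncomputable def count (S : Set CPerm) (n : ℕ) : ℕ := {p | p ∈ S ∧ p.len = n}.ncard

/-- The single-point centred permutation in quadrant `q`. -/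
def mu : ℕ → CPerm
  | 1 => ⟨[0, 1], 0⟩
  | 2 => ⟨[1, 0], 1⟩
  | 3 => ⟨[0, 1], 1⟩
  | 4 => ⟨[1, 0], 0⟩
  | _ => ⟨[0], 0⟩

def AdjacentQuadrants (a b : ℕ) : Prop :=
  (a, b) = (1, 2) ∨ (a, b) = (2, 3) ∨ (a, b) = (3, 4) ∨ (a, b) = (4, 1) ∨
  (a, b) = (2, 1) ∨ (a, b) = (3, 2) ∨ (a, b) = (4, 3) ∨ (a, b) = (1, 4)

/-- The adjacency condition on a centred class. -/
def AdjacencyCondition (S : Set CPerm) : Prop :=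
  (∃! q : ℕ, q ∈ ({1, 2, 3, 4} : Set ℕ) ∧ mu q ∈ S) ∨
    ∃ a b : ℕ, AdjacentQuadrants a b ∧ mu a ∈ S ∧ mu b ∈ S

end CPerm

inductive PinLetter | u | d | l | r
deriving DecidableEq

def PinLetter.isVert : PinLetter → Bool
  | .u => true
  | .d => true
  | .l => false
  | .r => false

/-- Letters strictly alternate between vertical and horizontal alignment. -/
def PinAlt (ls : List PinLetter) : Prop :=
  List.Chain' (fun a b => a.isVert ≠ b.isVert) ls

/-- A pin word: an initial numeral `q ∈ {1,…,4}` followed by alternating letters. -/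
def IsPinWord (q : ℕ) (ls : List PinLetter) : Prop := 1 ≤ q ∧ q ≤ 4 ∧ PinAlt ls

def firstPt : ℕ → ℚ × ℚ
  | 1 => (1, 1)
  | 2 => (-1, 1)
  | 3 => (-1, -1)
  | 4 => (1, -1)
  | _ => (1, 1)

def maxOf (l : List ℚ) : ℚ := l.foldr max 0
def minOf (l : List ℚ) : ℚ := l.foldr min 0

/-- Place the next pin: beyond the bounding rectangle in the given direction,
separating the previous point from all the others. The list holds the points
newest-first; the origin `(0,0)` is the last entry. -/
def pinStep (pts : List (ℚ × ℚ)) (dir : PinLetter) : List (ℚ × ℚ) :=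
  let last := pts.headD (0, 0)
  let rest := pts.tail
  let btwY : ℚ :=
    if maxOf (rest.map Prod.snd) < last.2 then (last.2 + maxOf (rest.map Prod.snd)) / 2
    else (last.2 + minOf (rest.map Prod.snd)) / 2
  let btwX : ℚ :=
    if maxOf (rest.map Prod.fst) < last.1 then (last.1 + maxOf (rest.map Prod.fst)) / 2
    else (last.1 + minOf (rest.map Prod.fst)) / 2
  let np : ℚ × ℚ :=
    match dir with
    | .r => (maxOf (pts.map Prod.fst) + 1, btwY)
    | .l => (minOf (pts.map Prod.fst) - 1, btwY)
    | .u => (btwX, maxOf (pts.map Prod.snd) + 1)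
    | .d => (btwX, minOf (pts.map Prod.snd) - 1)
  np :: pts

/-- The points (newest first, origin last) drawn from a pin word. -/
def pinPts (q : ℕ) (ls : List PinLetter) : List (ℚ × ℚ) :=
  ls.foldl pinStep [firstPt q, (0, 0)]

/-- Convert a finite set of plane points (with origin `(0,0)`) into a centred
permutation in canonical form. -/
def toCPerm (pts : List (ℚ × ℚ)) : CPerm :=
  ⟨(pts.mergeSort (fun a b => decide (a.1 ≤ b.1))).map
      (fun pt => ((pts.map Prod.snd).filter (fun y => decide (y < pt.2))).length),
    ((pts.map Prod.fst).filter (fun x => decide (x < 0))).length⟩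

/-- The centred pin permutation of a pin word. -/
def pinPerm (q : ℕ) (ls : List PinLetter) : CPerm := toCPerm (pinPts q ls)

/-- The complete pin class `P°`: the downward closure of all box-sums of
centred pin permutations. -/
def CompletePinClass : Set CPerm :=
  {p | p.IsValid ∧
    ∃ ws : List (ℕ × List PinLetter), (∀ w ∈ ws, IsPinWord w.1 w.2) ∧
      CPerm.PatternLE p (CPerm.boxSumList (ws.map fun w => pinPerm w.1 w.2))}

/-- An infinite pin sequence: numeral `q` and letters `f 0, f 1, …`,
alternating in alignment. -/
def IsPinSeq (q : ℕ) (f : ℕ → PinLetter) : Prop :=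
  1 ≤ q ∧ q ≤ 4 ∧ ∀ n, (f n).isVert ≠ (f (n + 1)).isVert

def seqPrefix (f : ℕ → PinLetter) (n : ℕ) : List PinLetter := (List.range n).map f

/-- The pin class of an infinite pin sequence. -/
def PinClassOf (q : ℕ) (f : ℕ → PinLetter) : Set CPerm :=
  {p | p.IsValid ∧ ∃ n : ℕ, CPerm.PatternLE p (pinPerm q (seqPrefix f n))}

/-- The `i`-th point (`i ≥ 1`) placed when drawing the pin sequence. -/
def seqPoint (q : ℕ) (f : ℕ → PinLetter) (i : ℕ) : ℚ × ℚ :=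
  (pinPts q (seqPrefix f (i - 1))).headD (0, 0)

/-- The quadrant of a plane point. -/
def quadOf (pt : ℚ × ℚ) : ℕ :=
  if 0 < pt.1 then (if 0 < pt.2 then 1 else 4) else (if 0 < pt.2 then 2 else 3)

/-- The pin word `w` is the pin factor of the sequence starting at position `i ≥ 1`
(first letter replaced by the quadrant of the corresponding point). -/
def FactorAt (q : ℕ) (f : ℕ → PinLetter) (i : ℕ) (w : ℕ × List PinLetter) : Prop :=
  1 ≤ i ∧ w.1 = quadOf (seqPoint q f i) ∧
    ∀ t, t < w.2.length → w.2.getD t PinLetter.u = f (i - 1 + t)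

/-- A recurrent pin factor: one occurring arbitrarily late. -/
def RecurrentFactor (q : ℕ) (f : ℕ → PinLetter) (w : ℕ × List PinLetter) : Prop :=
  ∀ N : ℕ, ∃ i, N ≤ i ∧ FactorAt q f i w

/-- The ⊞-interior of a pin class: the ⊞-closure (as a class) of the
permutations generated by recurrent pin factors. -/
def BoxInterior (q : ℕ) (f : ℕ → PinLetter) : Set CPerm :=
  {p | p.IsValid ∧
    ∃ l : List CPerm,
      (∀ x ∈ l, ∃ w : ℕ × List PinLetter, RecurrentFactor q f w ∧ x = pinPerm w.1 w.2) ∧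
      CPerm.PatternLE p (CPerm.boxSumList l)}

namespace PinRatio

/-- Directed strict comparison. -/
def sl {β : Type*} [LT β] (b : Bool) (x y : β) : Prop := if b = true then x < y else y < x

def G {α β γ : Type*} [LT β] [LT γ] (X : α → β) (Y : α → γ) (P : α → Prop) (o i : α) : Prop :=
  ∃ c, c ≠ o ∧ ∃ s t, ∀ j, P j → sl s (X j) (X i) ∧ (j ≠ c → sl t (Y j) (Y i))

def Good {α β γ : Type*} [LT β] [LT γ] (X : α → β) (Y : α → γ) (P : α → Prop) (o i : α) : Prop :=
  G X Y P o i ∨ G Y X P o i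

theorem G.transport {α β γ α' β' γ' : Type*} [LT β] [LT γ] [LT β'] [LT γ']
    {X : α → β} {Y : α → γ} {P : α → Prop} {o i : α}
    {X' : α' → β'} {Y' : α' → γ'} {P' : α' → Prop} {o' : α'} (φ : α → α')
    (h : G X' Y' P' o' (φ i)) (hP : ∀ j, P j → P' (φ j)) (ho : φ o = o') (hi : i ≠ o)
    (inj : ∀ j k, P j → P k → φ j = φ k → φ j ≠ o' → j = k)
    (hX : ∀ j, P j → ∀ s, sl s (X' (φ j)) (X' (φ i)) → sl s (X j) (X i))
    (hY : ∀ j, P j → ∀ s, sl s (Y' (φ j)) (Y' (φ i)) → sl s (Y j) (Y i)) :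
    G X Y P o i := by
  obtain ⟨c', hc', s, t, H⟩ := h
  have : ∃ c, c ≠ o ∧ ∀ j, P j → φ j = c' → j = c := by
    by_cases hex : ∃ k, P k ∧ φ k = c'
    · obtain ⟨k, hk, hkc⟩ := hex
      refine ⟨k, ?_, ?_⟩
      · rintro rfl
        exact hc' (hkc.symm.trans ho)
      · intro j hj hjc
        exact inj j k hj hk (hjc.trans hkc.symm) (by rw [hjc]; exact hc')
    · refine ⟨i, hi, fun j hj hjc => (hex ⟨j, hj, hjc⟩).elim⟩
  obtain ⟨c, hc, hcc⟩ := this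
  refine ⟨c, hc, s, t, fun j hj => ⟨hX j hj _ (H _ (hP j hj)).1, fun hjc => hY j hj _ ?_⟩⟩
  exact (H _ (hP j hj)).2 (fun e => hjc (hcc j hj e))

theorem Good.transport {α β γ α' β' γ' : Type*} [LT β] [LT γ] [LT β'] [LT γ']
    {X : α → β} {Y : α → γ} {P : α → Prop} {o i : α}
    {X' : α' → β'} {Y' : α' → γ'} {P' : α' → Prop} {o' : α'} (φ : α → α')
    (h : Good X' Y' P' o' (φ i)) (hP : ∀ j, P j → P' (φ j)) (ho : φ o = o') (hi : i ≠ o)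
    (inj : ∀ j k, P j → P k → φ j = φ k → φ j ≠ o' → j = k)
    (hX : ∀ j, P j → ∀ s, sl s (X' (φ j)) (X' (φ i)) → sl s (X j) (X i))
    (hY : ∀ j, P j → ∀ s, sl s (Y' (φ j)) (Y' (φ i)) → sl s (Y j) (Y i)) :
    Good X Y P o i := by
  rcases h with h | h
  · exact Or.inl (h.transport φ hP ho hi inj hX hY)
  · exact Or.inr (h.transport φ hP ho hi inj hY hX)

/-- The points of `q` can be ranked so that each is well placed relative to the earlier ones. -/
def H (q : CPerm) : Prop :=
  ∃ r : ℕ → ℕ, (∀ i j, i < q.vals.length → j < q.vals.length → r i = r j → i = j) ∧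
    ∀ i, i < q.vals.length → i ≠ q.origin → r q.origin < r i ∧
      Good (fun k : ℕ => k) q.valAt (fun j => j < q.vals.length ∧ r j < r i) q.origin i

def Wf (q : CPerm) : Prop :=
  q.origin < q.vals.length ∧ ∀ i, i < q.vals.length → q.valAt i < q.vals.length

theorem H.mono {p q : CPerm} (hp : p.origin < p.vals.length) (h : CPerm.PatternLE p q) (hq : H q) :
    H p := by
  obtain ⟨f, f1, f2, f3, f4⟩ := h
  obtain ⟨r, r1, r2⟩ := hq
  have finj : ∀ i j, i < p.vals.length → j < p.vals.length → f i = f j → i = j := by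
    intro i j hi hj e
    rcases lt_trichotomy i j with h | h | h
    · have := f1 i j hi hj h; omega
    · exact h
    · have := f1 j i hj hi h; omega
  refine ⟨fun i => r (f i), ?_, ?_⟩
  · intro i j hi hj e
    exact finj i j hi hj (r1 _ _ (f2 i hi) (f2 j hj) e)
  · intro i hi hio
    have hfo : f i ≠ q.origin := fun e => hio (finj i _ hi hp (e.trans f3.symm))
    obtain ⟨h1, h2⟩ := r2 (f i) (f2 i hi) hfo
    refine ⟨by simpa [f3] using h1, ?_⟩
    refine h2.transport f ?_ f3 hio ?_ ?_ ?_
    · rintro j ⟨hj, hr⟩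
      exact ⟨f2 j hj, hr⟩
    · rintro j k ⟨hj, _⟩ ⟨hk, _⟩ e _
      exact finj j k hj hk e
    · rintro j ⟨hj, hr⟩ s hs
      have hne : j ≠ i := by rintro rfl; exact lt_irrefl _ hr
      rcases lt_trichotomy j i with h | h | h
      · have := f1 j i hj hi h
        cases s <;> simp [sl] at hs ⊢ <;> omega
      · exact (hne h).elim
      · have := f1 i j hi hj h
        cases s <;> simp [sl] at hs ⊢ <;> omega
    · rintro j ⟨hj, hr⟩ s hs
      cases s
      · simp only [sl, Bool.false_eq_true, if_false] at hs ⊢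
        exact (f4 i j hi hj).2 hs
      · simp only [sl, if_true] at hs ⊢
        exact (f4 j i hj hi).2 hs

def shift (v N u : ℕ) : ℕ := if u < v then u else u + (N - 1)

theorem boxSum_length {a b : CPerm} (ha : Wf a) (hb : Wf b) :
    (CPerm.boxSum a b).vals.length = a.vals.length + b.vals.length - 1 := by
  have := ha.1
  have := hb.1
  simp [CPerm.boxSum]
  omega

theorem boxSum_origin (a b : CPerm) : (CPerm.boxSum a b).origin = b.origin + a.origin := rfl

theorem boxSum_left {a b : CPerm} (hb : Wf b) {i : ℕ} (hi : i < b.origin) :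
    (CPerm.boxSum a b).valAt i = shift b.originVal a.vals.length (b.valAt i) := by
  have := hb.1
  have h2 : i < b.vals.length := by omega
  simp [CPerm.boxSum, CPerm.valAt, List.getD_eq_getElem?_getD, List.getElem?_append, hi, shift, h2,
    List.getElem?_take, this.le]

theorem boxSum_mid {a b : CPerm} (hb : Wf b) {i : ℕ} (hi : b.origin ≤ i)
    (hi' : i < b.origin + a.vals.length) :
    (CPerm.boxSum a b).valAt i = a.valAt (i - b.origin) + b.originVal := by
  have := hb.1
  have h2 : i - b.origin < a.vals.length := by omega
  simp [CPerm.boxSum, CPerm.valAt, List.getD_eq_getElem?_getD, List.getElem?_append, hi, h2,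
    this.le, hi', not_lt.2 hi]

theorem boxSum_right {a b : CPerm} (ha : Wf a) (hb : Wf b) {i : ℕ}
    (hi : b.origin + a.vals.length ≤ i) (hi' : i < a.vals.length + b.vals.length - 1) :
    (CPerm.boxSum a b).valAt i =
      shift b.originVal a.vals.length (b.valAt (i - (a.vals.length - 1))) := by
  have := hb.1
  have := ha.1
  have h1 : ¬ i < b.origin := by omega
  have h2 : ¬ i < b.origin + a.vals.length := by omega
  have h3 : b.origin + 1 + (i - (b.origin + a.vals.length)) = i - (a.vals.length - 1) := by omega
  have h4 : i - (a.vals.length - 1) < b.vals.length := by omega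
  have h5 : ¬ (i - b.origin < a.vals.length) := by omega
  simp [CPerm.boxSum, CPerm.valAt, List.getD_eq_getElem?_getD, List.getElem?_append, h1, h2, hb.1.le,
    h3, h4, shift, h5, Nat.sub_sub]

/-- projection of indices of the box sum onto the indices of the outer part -/
def proj (o N i : ℕ) : ℕ := if i < o then i else if i < o + N then o else i - (N - 1)

theorem boxSum_outer {a b : CPerm} (ha : Wf a) (hb : Wf b) {i : ℕ}
    (hi : i < a.vals.length + b.vals.length - 1) (h : proj b.origin a.vals.length i ≠ b.origin) :
    (CPerm.boxSum a b).valAt i =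
      shift b.originVal a.vals.length (b.valAt (proj b.origin a.vals.length i)) := by
  unfold proj at *
  split_ifs at * with h1 h2
  · exact boxSum_left hb h1
  · exact (h rfl).elim
  · exact boxSum_right ha hb (by omega) hi

theorem boxSum_inner {a b : CPerm} (ha : Wf a) (hb : Wf b) {i : ℕ}
    (h : proj b.origin a.vals.length i = b.origin) :
    b.origin ≤ i ∧ i < b.origin + a.vals.length := by
  have := ha.1
  unfold proj at *
  split_ifs at * with h1 h2 <;> omega

theorem proj_lt {a b : CPerm} (ha : Wf a) (hb : Wf b) {i : ℕ}
    (hi : i < a.vals.length + b.vals.length - 1) :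
    proj b.origin a.vals.length i < b.vals.length := by
  have := ha.1
  have := hb.1
  unfold proj
  split_ifs <;> omega

theorem Wf.boxSum {a b : CPerm} (ha : Wf a) (hb : Wf b) : Wf (CPerm.boxSum a b) := by
  have ha1 := ha.1
  have hb1 := hb.1
  have hl := boxSum_length ha hb
  refine ⟨?_, ?_⟩
  · rw [hl, boxSum_origin]; omega
  · intro i hi
    rw [hl] at hi ⊢
    have h0 := hb.2 _ hb.1
    by_cases h : proj b.origin a.vals.length i = b.origin
    · obtain ⟨h1, h2⟩ := boxSum_inner ha hb h
      rw [boxSum_mid hb h1 h2]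
      have := ha.2 (i - b.origin) (by omega)
      unfold CPerm.originVal
      omega
    · rw [boxSum_outer ha hb hi h]
      have := hb.2 _ (proj_lt ha hb hi)
      unfold shift
      split_ifs <;> omega

theorem H.boxSum {a b : CPerm} (ha : Wf a) (hb : Wf b) (Ha : H a) (Hb : H b) :
    H (CPerm.boxSum a b) := by
  have ha1 := ha.1
  have hb1 := hb.1
  obtain ⟨ra, ra1, ra2⟩ := Ha
  obtain ⟨rb, rb1, rb2⟩ := Hb
  obtain ⟨M, hM⟩ : ∃ M, ∀ i, i < a.vals.length → ra i < M := by
    refine ⟨(Finset.range a.vals.length).sup ra + 1, fun i hi => ?_⟩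
    exact Nat.lt_succ_of_le (Finset.le_sup (f := ra) (Finset.mem_range.2 hi))
  set π := proj b.origin a.vals.length with hπ
  have hpo : π (b.origin + a.origin) = b.origin := by
    simp [hπ, proj, ha1]
  have hin : ∀ i, π i = b.origin → b.origin ≤ i ∧ i < b.origin + a.vals.length :=
    fun i => boxSum_inner ha hb
  have πinj : ∀ i j, π i = π j → π i ≠ b.origin → i = j := by
    intro i j
    simp only [hπ, proj]
    split_ifs <;> omega
  set r : ℕ → ℕ := fun i => if π i = b.origin then ra (i - b.origin) else rb (π i) + M with hr
  refine ⟨r, ?_, ?_⟩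
  · rw [boxSum_length ha hb]
    intro i j hi hj e
    simp only [hr] at e
    have hpi := proj_lt ha hb hi
    have hpj := proj_lt ha hb hj
    split_ifs at e with h1 h2 h2
    · have := hin i h1
      have := hin j h2
      have := ra1 _ _ (by omega) (by omega) e
      omega
    · have := hin i h1
      have := hM (i - b.origin) (by omega)
      omega
    · have := hin j h2
      have := hM (j - b.origin) (by omega)
      omega
    · exact πinj i j (rb1 _ _ hpi hpj (by omega)) h1
  · rw [boxSum_length ha hb, boxSum_origin]
    intro i hi hio
    have hro : r (b.origin + a.origin) = ra a.origin := by
      simp [hr, hpo]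
    by_cases h : π i = b.origin
    · obtain ⟨h1, h2⟩ := hin i h
      have hri : r i = ra (i - b.origin) := by simp [hr, h]
      obtain ⟨g1, g2⟩ := ra2 (i - b.origin) (by omega) (by omega)
      refine ⟨by omega, ?_⟩
      have hPj : ∀ j, (j < a.vals.length + b.vals.length - 1 ∧ r j < r i) → π j = b.origin := by
        rintro j ⟨hj, hlt⟩
        by_contra hne
        have : r j = rb (π j) + M := by simp [hr, hne]
        have := hM (i - b.origin) (by omega)
        omega
      refine g2.transport (fun j => j - b.origin) ?_ (by simp) hio ?_ ?_ ?_
      · rintro j hj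
        have e := hPj j hj
        have := hin j e
        have hrj : r j = ra (j - b.origin) := by simp [hr, e]
        exact ⟨by omega, by omega⟩
      · intro j k hj hk e _
        have := hin j (hPj j hj)
        have := hin k (hPj k hk)
        omega
      · intro j hj s hs
        have := hin j (hPj j hj)
        cases s <;> simp [sl] at hs ⊢ <;> omega
      · intro j hj s hs
        have h5 := hin j (hPj j hj)
        rw [boxSum_mid hb h1 h2, boxSum_mid hb h5.1 h5.2]
        cases s <;> simp [sl] at hs ⊢ <;> omega
    · have hri : r i = rb (π i) + M := by simp [hr, h]
      obtain ⟨g1, g2⟩ := rb2 (π i) (proj_lt ha hb hi) h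
      have := hM a.origin ha1
      refine ⟨by omega, ?_⟩
      refine g2.transport π ?_ hpo hio ?_ ?_ ?_
      · rintro j ⟨hj, hlt⟩
        refine ⟨proj_lt ha hb hj, ?_⟩
        by_cases e : π j = b.origin
        · rw [e]; exact g1
        · have hrj : r j = rb (π j) + M := by simp [hr, e]
          omega
      · intro j k hj hk e hne
        exact πinj j k e hne
      · rintro j ⟨hj, hlt⟩ s hs
        simp only [hπ, proj] at hs h
        cases s <;> simp only [sl, Bool.false_eq_true, if_false, if_true] at hs ⊢ <;>
          split_ifs at hs h <;> omega
      · rintro j ⟨hj, hlt⟩ s hs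
        rw [boxSum_outer ha hb hi h]
        by_cases e : π j = b.origin
        · obtain ⟨h5, h6⟩ := hin j e
          rw [boxSum_mid hb h5 h6]
          rw [e] at hs
          have hv := ha.2 (j - b.origin) (by omega)
          change sl s b.originVal (b.valAt (π i)) at hs
          change sl s _ (shift b.originVal a.vals.length (b.valAt (π i)))
          unfold shift
          cases s <;> simp only [sl, Bool.false_eq_true, if_false, if_true] at hs ⊢ <;>
            split_ifs <;> omega
        · rw [boxSum_outer ha hb hj e]
          change sl s (shift b.originVal a.vals.length (b.valAt (π j)))
            (shift b.originVal a.vals.length (b.valAt (π i)))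
          unfold shift
          cases s <;> simp only [sl, Bool.false_eq_true, if_false, if_true] at hs ⊢ <;>
            split_ifs <;> omega

theorem H_trivial : H CPerm.trivial := by
  refine ⟨fun _ => 0, ?_, ?_⟩
  · intro i j hi hj _
    simp [CPerm.trivial] at hi hj
    omega
  · intro i hi hio
    simp [CPerm.trivial] at hi hio
    omega

theorem Wf_trivial : Wf CPerm.trivial := by
  refine ⟨by simp [CPerm.trivial], ?_⟩
  intro i hi
  simp [CPerm.trivial] at hi
  subst hi
  simp [CPerm.trivial, CPerm.valAt]

theorem H_list (l : List CPerm) (h : ∀ x ∈ l, Wf x ∧ H x) :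
    Wf (CPerm.boxSumList l) ∧ H (CPerm.boxSumList l) := by
  induction l with
  | nil => exact ⟨Wf_trivial, H_trivial⟩
  | cons x l ih =>
    have h1 := h x (by simp)
    have h2 := ih (fun y hy => h y (by simp [hy]))
    exact ⟨h1.1.boxSum h2.1, H.boxSum h1.1 h2.1 h1.2 h2.2⟩

/-! Pin sequences in the plane. -/

/-- Invariant of a pin sequence. -/
structure Inv (pts : List (ℚ × ℚ)) : Prop where
  zero_mem : (0, 0) ∈ pts
  nodup : pts.Nodup
  ne : ∀ p ∈ pts, p.1 = 0 → p = (0, 0)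
  rank : ∃ r : ℚ × ℚ → ℕ, (∀ p ∈ pts, ∀ q ∈ pts, r p = r q → p = q) ∧
    ∀ p ∈ pts, p ≠ (0, 0) → r (0, 0) < r p ∧
      Good Prod.fst Prod.snd (fun q => q ∈ pts ∧ r q < r p) (0, 0) p

theorem Inv.cons {pts : List (ℚ × ℚ)} (h : Inv pts) (p : ℚ × ℚ) (hp : p ∉ pts) (h0 : p.1 ≠ 0)
    (hg : Good Prod.fst Prod.snd (fun q => q ∈ pts) (0, 0) p) : Inv (p :: pts) := by
  obtain ⟨z, nd, ne, r, r1, r2⟩ := h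
  obtain ⟨M, hM⟩ : ∃ M, ∀ q ∈ pts, r q < M := by
    refine ⟨(pts.toFinset).sup r + 1, fun i hi => ?_⟩
    exact Nat.lt_succ_of_le (Finset.le_sup (f := r) (List.mem_toFinset.2 hi))
  have hne : ∀ q ∈ pts, q ≠ p := by
    rintro q hq rfl
    exact hp hq
  have hz := hne _ z
  refine ⟨by simp [z], by simp [hp, nd], ?_, fun q => if q = p then M else r q, ?_, ?_⟩
  · intro q hq
    rcases List.mem_cons.1 hq with rfl | hq
    · intro e; exact (h0 e).elim
    · exact ne q hq
  · intro a ha b hb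
    rcases List.mem_cons.1 ha with rfl | ha' <;> rcases List.mem_cons.1 hb with rfl | hb'
    · simp
    · have := hM b hb'
      simp [hne b hb']; omega
    · have := hM a ha'
      simp [hne a ha']; omega
    · simp only [hne a ha', hne b hb', if_false]
      exact r1 a ha' b hb'
  · intro a ha ha0
    rcases List.mem_cons.1 ha with rfl | ha'
    · refine ⟨by simpa [hz] using hM _ z, ?_⟩
      refine hg.transport id ?_ rfl ha0 (fun _ _ _ _ e _ => e) (fun _ _ _ e => e) (fun _ _ _ e => e)
      rintro j ⟨hj, hlt⟩
      rcases List.mem_cons.1 hj with rfl | hj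
      · simp at hlt
      · exact hj
    · obtain ⟨g1, g2⟩ := r2 a ha' ha0
      refine ⟨by simpa [hz, hne a ha'] using g1, ?_⟩
      refine g2.transport id ?_ rfl ha0 (fun _ _ _ _ e _ => e) (fun _ _ _ e => e) (fun _ _ _ e => e)
      rintro j ⟨hj, hlt⟩
      simp only [hne a ha', if_false] at hlt
      rcases List.mem_cons.1 hj with rfl | hj
      · have := hM a ha'
        simp at hlt; omega
      · simp only [hne j hj, if_false] at hlt
        exact ⟨hj, hlt⟩

theorem le_maxOf (l : List ℚ) : 0 ≤ maxOf l ∧ ∀ x ∈ l, x ≤ maxOf l := by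
  induction l with
  | nil => simp [maxOf]
  | cons a l ih =>
    have : maxOf (a :: l) = max a (maxOf l) := rfl
    rw [this]
    refine ⟨le_max_of_le_right ih.1, ?_⟩
    intro x hx
    rcases List.mem_cons.1 hx with rfl | hx
    · exact le_max_left _ _
    · exact le_max_of_le_right (ih.2 x hx)

theorem minOf_le (l : List ℚ) : minOf l ≤ 0 ∧ ∀ x ∈ l, minOf l ≤ x := by
  induction l with
  | nil => simp [minOf]
  | cons a l ih =>
    have : minOf (a :: l) = min a (minOf l) := rfl
    rw [this]
    refine ⟨min_le_of_right_le ih.1, ?_⟩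
    intro x hx
    rcases List.mem_cons.1 hx with rfl | hx
    · exact min_le_left _ _
    · exact min_le_of_right_le (ih.2 x hx)

/-- The newest value is strictly extreme among the values `l` and zero. -/
def Sep (x : ℚ) (l : List ℚ) : Prop := maxOf l < x ∨ x < minOf l

def btw (x : ℚ) (l : List ℚ) : ℚ := if maxOf l < x then (x + maxOf l) / 2 else (x + minOf l) / 2

theorem btw_spec {x : ℚ} {l : List ℚ} (h : Sep x l) :
    x ≠ 0 ∧ btw x l ≠ 0 ∧ ∃ t, ∀ y ∈ l, sl t y (btw x l) := by
  have h1 := le_maxOf l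
  have h2 := minOf_le l
  unfold btw
  by_cases hx : maxOf l < x
  · simp only [hx, if_true]
    refine ⟨by linarith, by linarith, true, ?_⟩
    intro y hy
    have := h1.2 y hy
    simp only [sl, if_true]
    linarith
  · have hx' : x < minOf l := h.resolve_left hx
    simp only [hx, if_false]
    refine ⟨by linarith, by linarith, false, ?_⟩
    intro y hy
    have := h2.2 y hy
    simp only [sl, Bool.false_eq_true, if_false]
    linarith

theorem ext_spec (b : Bool) (l : List ℚ) :
    let x := if b = true then maxOf l + 1 else minOf l - 1
    x ≠ 0 ∧ Sep x l ∧ ∀ y ∈ l, sl b y x := by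
  have h1 := le_maxOf l
  have h2 := minOf_le l
  cases b
  · simp only [Bool.false_eq_true, if_false, sl]
    refine ⟨by linarith, Or.inr (by linarith), ?_⟩
    intro y hy
    have := h2.2 y hy
    linarith
  · simp only [if_true, sl]
    refine ⟨by linarith, Or.inl (by linarith), ?_⟩
    intro y hy
    have := h1.2 y hy
    linarith

theorem sl_irrefl (b : Bool) (x : ℚ) : ¬ sl b x x := by
  cases b <;> simp [sl]

/-- Invariant plus: ready for a letter of the given alignment. -/
def Ready (v : Bool) (pts : List (ℚ × ℚ)) : Prop :=
  ∃ p rest, pts = p :: rest ∧ if v = true then Sep p.1 (rest.map Prod.fst)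
    else Sep p.2 (rest.map Prod.snd)

theorem step_vert {pts : List (ℚ × ℚ)} (h : Inv pts) (hr : Ready true pts) (b : Bool)
    (np : ℚ × ℚ)
    (hnp : np = (btw (pts.headD (0, 0)).1 (pts.tail.map Prod.fst),
      if b = true then maxOf (pts.map Prod.snd) + 1 else minOf (pts.map Prod.snd) - 1)) :
    Inv (np :: pts) ∧ Ready false (np :: pts) := by
  obtain ⟨p, rest, rfl, hs⟩ := hr
  simp only [if_true] at hs
  simp only [List.headD_cons, List.tail_cons] at hnp
  obtain ⟨b1, b2, t, b3⟩ := btw_spec hs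
  obtain ⟨e1, e2, e3⟩ := ext_spec b ((p :: rest).map Prod.snd)
  have k1 : np.1 = btw p.1 (rest.map Prod.fst) := by rw [hnp]
  have k2 : np.2 = if b = true then maxOf ((p :: rest).map Prod.snd) + 1
    else minOf ((p :: rest).map Prod.snd) - 1 := by rw [hnp]
  rw [← k2] at e1 e2 e3
  rw [← k1] at b2 b3
  have e4 : ∀ q ∈ p :: rest, sl b q.2 np.2 := fun q hq => e3 _ (List.mem_map_of_mem hq)
  refine ⟨h.cons np ?_ b2 (Or.inr ⟨p, ?_, b, t, ?_⟩), np, _, rfl, by simpa using e2⟩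
  · intro hm
    exact sl_irrefl _ _ (e4 np hm)
  · rintro rfl
    exact b1 rfl
  · intro j hj
    refine ⟨e4 j hj, fun hjp => ?_⟩
    rcases List.mem_cons.1 hj with rfl | hj
    · exact (hjp rfl).elim
    · exact b3 _ (List.mem_map_of_mem hj)

theorem step_horiz {pts : List (ℚ × ℚ)} (h : Inv pts) (hr : Ready false pts) (b : Bool)
    (np : ℚ × ℚ)
    (hnp : np = (if b = true then maxOf (pts.map Prod.fst) + 1 else minOf (pts.map Prod.fst) - 1,
      btw (pts.headD (0, 0)).2 (pts.tail.map Prod.snd))) :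
    Inv (np :: pts) ∧ Ready true (np :: pts) := by
  obtain ⟨p, rest, rfl, hs⟩ := hr
  simp only [Bool.false_eq_true, if_false] at hs
  simp only [List.headD_cons, List.tail_cons] at hnp
  obtain ⟨b1, b2, t, b3⟩ := btw_spec hs
  obtain ⟨e1, e2, e3⟩ := ext_spec b ((p :: rest).map Prod.fst)
  have k1 : np.2 = btw p.2 (rest.map Prod.snd) := by rw [hnp]
  have k2 : np.1 = if b = true then maxOf ((p :: rest).map Prod.fst) + 1
    else minOf ((p :: rest).map Prod.fst) - 1 := by rw [hnp]
  rw [← k2] at e1 e2 e3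
  rw [← k1] at b2 b3
  have e4 : ∀ q ∈ p :: rest, sl b q.1 np.1 := fun q hq => e3 _ (List.mem_map_of_mem hq)
  refine ⟨h.cons np ?_ e1 (Or.inl ⟨p, ?_, b, t, ?_⟩), np, _, rfl, by simpa using e2⟩
  · intro hm
    exact sl_irrefl _ _ (e4 np hm)
  · rintro rfl
    exact b1 rfl
  · intro j hj
    refine ⟨e4 j hj, fun hjp => ?_⟩
    rcases List.mem_cons.1 hj with rfl | hj
    · exact (hjp rfl).elim
    · exact b3 _ (List.mem_map_of_mem hj)

theorem step {pts : List (ℚ × ℚ)} (h : Inv pts) (a : PinLetter) (hr : Ready a.isVert pts) :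
    Inv (pinStep pts a) ∧ Ready (!a.isVert) (pinStep pts a) := by
  cases a
  · exact step_vert h hr true _ rfl
  · exact step_vert h hr false _ rfl
  · exact step_horiz h hr false _ rfl
  · exact step_horiz h hr true _ rfl

theorem fold_inv (ls : List PinLetter) : ∀ pts, Inv pts → PinAlt ls →
    (∀ a ∈ ls.head?, Ready a.isVert pts) → Inv (ls.foldl pinStep pts) := by
  induction ls with
  | nil => intro pts h _ _; exact h
  | cons a ls ih =>
    intro pts h hc hr
    have h1 := step h a (hr a (by simp))
    have hc' := List.isChain_cons.1 hc
    refine ih _ h1.1 hc'.2 ?_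
    intro b hb
    have h2 := hc'.1 b hb
    have : b.isVert = !a.isVert := by
      cases a <;> cases b <;> simp [PinLetter.isVert] at h2 ⊢
    rw [this]
    exact h1.2

theorem inv_zero : Inv [(0, 0)] := by
  refine ⟨by simp, by simp, by simp, fun _ => 0, ?_, ?_⟩
  · intro p hp q hq _
    simp at hp hq
    rw [hp, hq]
  · intro p hp hp0
    simp at hp
    exact (hp0 hp).elim

theorem inv_start (q : ℕ) : Inv [firstPt q, (0, 0)] ∧ ∀ v, Ready v [firstPt q, (0, 0)] := by
  have key : ∀ s t : Bool, ∀ p : ℚ × ℚ, p = (if s = true then 1 else -1, if t = true then 1 else -1) →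
      Inv [p, (0, 0)] ∧ ∀ v, Ready v [p, (0, 0)] := by
    rintro s t p rfl
    refine ⟨inv_zero.cons _ ?_ ?_ (Or.inl ⟨(1, 1), ?_, s, t, ?_⟩), ?_⟩
    · cases s <;> simp
    · cases s <;> simp
    · simp
    · intro j hj
      simp at hj
      subst hj
      cases s <;> cases t <;> simp [sl]
    · intro v
      refine ⟨_, _, rfl, ?_⟩
      cases v <;> cases s <;> cases t <;> simp [Sep, maxOf, minOf]
  unfold firstPt
  split
  · exact key true true _ (by simp)
  · exact key false true _ (by simp)
  · exact key false false _ (by simp)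
  · exact key true false _ (by simp)
  · exact key true true _ (by simp)

theorem inv_pinPts (q : ℕ) (ls : List PinLetter) (h : PinAlt ls) : Inv (pinPts q ls) :=
  fold_inv ls _ (inv_start q).1 h (fun _ _ => (inv_start q).2 _)

theorem toCPerm_spec {pts : List (ℚ × ℚ)} (h : Inv pts) : Wf (toCPerm pts) ∧ H (toCPerm pts) := by
  obtain ⟨z, nd, ne, r, r1, r2⟩ := h
  set srt := pts.mergeSort (fun a b => decide (a.1 ≤ b.1)) with hsrt
  have perm : srt.Perm pts := List.mergeSort_perm _ _
  have pw : srt.Pairwise (fun a b => a.1 ≤ b.1) := by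
    have := List.pairwise_mergeSort (le := fun a b : ℚ × ℚ => decide (a.1 ≤ b.1))
      (by intro a b c; simp only [decide_eq_true_eq]; exact le_trans)
      (by intro a b; simpa using le_total a.1 b.1) pts
    simpa using this
  have snd : srt.Nodup := perm.nodup_iff.2 nd
  have hlen : srt.length = pts.length := perm.length_eq
  have hvl : (toCPerm pts).vals.length = srt.length := by simp [toCPerm, hsrt]
  set φ : ℕ → ℚ × ℚ := fun i => srt.getD i (0, 0) with hφ
  have φe : ∀ i (hi : i < srt.length), φ i = srt[i] := fun i hi => by simp [hφ, hi]
  have φmem : ∀ i, i < srt.length → φ i ∈ pts := fun i hi => by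
    rw [φe i hi]; exact perm.mem_iff.1 (List.getElem_mem hi)
  have φinj : ∀ i j, i < srt.length → j < srt.length → φ i = φ j → i = j := by
    intro i j hi hj e
    rw [φe i hi, φe j hj] at e
    exact (snd.getElem_inj_iff).1 e
  have φmono : ∀ i j, i < srt.length → j < srt.length → (φ j).1 < (φ i).1 → j < i := by
    intro i j hi hj hlt
    by_contra hcon
    rcases (not_lt.1 hcon).lt_or_eq with hc | hc
    · have := List.pairwise_iff_getElem.1 pw i j hi hj hc
      rw [φe i hi, φe j hj] at hlt
      linarith
    · rw [hc] at hlt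
      exact lt_irrefl _ hlt
  have hval : ∀ i, i < srt.length → (toCPerm pts).valAt i =
      ((pts.map Prod.snd).filter (fun y => decide (y < (φ i).2))).length := by
    intro i hi
    rw [φe i hi]
    simp [toCPerm, CPerm.valAt, List.getD_eq_getElem?_getD, ← hsrt, hi]
  have hcnt : ∀ p ∈ pts, ∀ q ∈ pts, p.2 < q.2 →
      ((pts.map Prod.snd).filter (fun y => decide (y < p.2))).length <
      ((pts.map Prod.snd).filter (fun y => decide (y < q.2))).length := by
    intro p hp q hq hlt
    rw [← List.countP_eq_length_filter, ← List.countP_eq_length_filter]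
    obtain ⟨l1, l2, hl⟩ := List.append_of_mem (List.mem_map_of_mem (f := Prod.snd) hp)
    rw [hl]
    have m : ∀ l : List ℚ, l.countP (fun y => decide (y < p.2)) ≤
        l.countP (fun y => decide (y < q.2)) := by
      intro l
      apply List.countP_mono_left
      intro x _ hx
      simp only [decide_eq_true_eq] at hx ⊢
      exact hx.trans hlt
    have := m l1
    have := m l2
    simp [List.countP_append, List.countP_cons, hlt]
    omega
  have hcl : ∀ p ∈ pts,
      ((pts.map Prod.snd).filter (fun y => decide (y < p.2))).length < pts.length := by
    intro p hp
    rw [← List.length_map (f := Prod.snd)]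
    apply List.length_filter_lt_length_iff_exists.2
    exact ⟨p.2, List.mem_map_of_mem hp, by simp⟩
  have ho : (toCPerm pts).origin < srt.length ∧ φ (toCPerm pts).origin = (0, 0) := by
    obtain ⟨k, hk, hk0⟩ := List.mem_iff_getElem.1 (perm.mem_iff.2 z)
    have e1 : (toCPerm pts).origin = srt.countP (fun p => decide (p.1 < 0)) := by
      rw [perm.countP_eq]
      simp [toCPerm, ← List.countP_eq_length_filter, List.countP_map, Function.comp_def]
    have e2 : srt.countP (fun p => decide (p.1 < 0)) = k := by
      conv_lhs => rw [← List.take_append_drop k srt]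
      rw [List.countP_append]
      have a1 : (srt.take k).countP (fun p => decide (p.1 < 0)) = (srt.take k).length := by
        rw [List.countP_eq_length]
        intro p hp
        obtain ⟨j, hj, rfl⟩ := List.mem_iff_getElem.1 hp
        have hj' : j < k := by
          simp at hj; omega
        rw [List.getElem_take]
        have h1 := List.pairwise_iff_getElem.1 pw j k (by omega) hk hj'
        rw [hk0] at h1
        have h2 : (srt[j]'(by omega)).1 ≠ 0 := by
          intro h3
          have h4 := ne _ (perm.mem_iff.1 (List.getElem_mem (by omega : j < srt.length))) h3
          rw [← hk0] at h4
          have := (snd.getElem_inj_iff).1 h4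
          omega
        simp only [decide_eq_true_eq]
        exact lt_of_le_of_ne h1 h2
      have a2 : (srt.drop k).countP (fun p => decide (p.1 < 0)) = 0 := by
        rw [List.countP_eq_zero]
        intro p hp
        obtain ⟨j, hj, rfl⟩ := List.mem_iff_getElem.1 hp
        rw [List.getElem_drop]
        simp only [List.length_drop] at hj
        simp only [decide_eq_true_eq, not_lt]
        rcases Nat.eq_zero_or_pos j with rfl | hpos
        · simp [hk0]
        · have h1 := List.pairwise_iff_getElem.1 pw k (k + j) hk (by omega) (by omega)
          rw [hk0] at h1
          exact h1
      rw [a1, a2, List.length_take]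
      omega
    rw [e1, e2]
    exact ⟨hk, by rw [φe k hk, hk0]⟩
  refine ⟨⟨by rw [hvl]; exact ho.1, ?_⟩, fun i => r (φ i), ?_, ?_⟩
  · intro i hi
    rw [hvl] at hi ⊢
    rw [hval i hi, hlen]
    exact hcl _ (φmem i hi)
  · rw [hvl]
    intro i j hi hj e
    exact φinj i j hi hj (r1 _ (φmem i hi) _ (φmem j hj) e)
  · rw [hvl]
    intro i hi hio
    have hne : φ i ≠ (0, 0) := fun e => hio (φinj _ _ hi ho.1 (e.trans ho.2.symm))
    obtain ⟨g1, g2⟩ := r2 _ (φmem i hi) hne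
    refine ⟨by simpa only [ho.2] using g1, ?_⟩
    refine g2.transport φ ?_ ho.2 hio ?_ ?_ ?_
    · rintro j ⟨hj, hlt⟩
      exact ⟨φmem j hj, hlt⟩
    · rintro j k ⟨hj, _⟩ ⟨hk, _⟩ e _
      exact φinj j k hj hk e
    · rintro j ⟨hj, _⟩ s hs
      cases s
      · simp only [sl, Bool.false_eq_true, if_false] at hs ⊢
        exact φmono j i hj hi hs
      · simp only [sl, if_true] at hs ⊢
        exact φmono i j hi hj hs
    · rintro j ⟨hj, _⟩ s hs
      rw [hval i hi, hval j hj]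
      cases s
      · simp only [sl, Bool.false_eq_true, if_false] at hs ⊢
        exact hcnt _ (φmem i hi) _ (φmem j hj) hs
      · simp only [sl, if_true] at hs ⊢
        exact hcnt _ (φmem j hj) _ (φmem i hi) hs

theorem H_of_mem {p : CPerm} (hp : p ∈ CompletePinClass) : H p := by
  obtain ⟨hv, ws, hws, hle⟩ := hp
  refine H.mono hv.2.1 hle (H_list _ ?_).2
  intro x hx
  obtain ⟨w, hw, rfl⟩ := List.mem_map.1 hx
  exact toCPerm_spec (inv_pinPts _ _ (hws w hw).2.2)

/-! Deletion and insertion of points. -/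

/-- The twelve positions. -/
def positions (n : ℕ) : List (ℕ × ℕ) :=
  [(0, 0), (0, 1), (0, n - 1), (0, n), (n, 0), (n, 1), (n, n - 1), (n, n),
    (1, 0), (n - 1, 0), (1, n), (n - 1, n)]

theorem valid_lt {p : CPerm} (h : p.IsValid) {i : ℕ} (hi : i < p.vals.length) :
    p.valAt i < p.vals.length := by
  have : p.valAt i ∈ p.vals := by
    simp [CPerm.valAt, List.getD_eq_getElem?_getD, hi]
  exact List.mem_range.1 (h.2.2.mem_iff.1 this)

theorem valid_inj {p : CPerm} (h : p.IsValid) {i j : ℕ} (hi : i < p.vals.length)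
    (hj : j < p.vals.length) (e : p.valAt i = p.valAt j) : i = j := by
  have nd : p.vals.Nodup := h.2.2.nodup_iff.2 List.nodup_range
  simp only [CPerm.valAt, List.getD_eq_getElem?_getD, hi, hj, List.getElem?_eq_getElem,
    Option.getD_some] at e
  exact (nd.getElem_inj_iff).1 e

theorem valid_surj {p : CPerm} (h : p.IsValid) {v : ℕ} (hv : v < p.vals.length) :
    ∃ i, i < p.vals.length ∧ p.valAt i = v := by
  obtain ⟨i, hi, e⟩ := List.mem_iff_getElem.1 (h.2.2.mem_iff.2 (List.mem_range.2 hv))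
  exact ⟨i, hi, by simp [CPerm.valAt, List.getD_eq_getElem?_getD, hi, e]⟩

theorem rank_of_ext {X : ℕ → ℕ} {N i : ℕ} (hi : i < N) (hX : ∀ j, j < N → X j < N)
    (hs : ∀ v, v < N → ∃ j, j < N ∧ X j = v) (s : Bool)
    (h : ∀ j, j < N → j ≠ i → sl s (X j) (X i)) : X i = 0 ∨ X i = N - 1 := by
  have := hX i hi
  cases s <;> simp only [sl, Bool.false_eq_true, if_false, if_true] at h
  · left
    obtain ⟨j, hj, e⟩ := hs 0 (by omega)
    by_cases hji : j = i
    · rw [← hji]; exact e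
    · have := h j hj hji; omega
  · right
    obtain ⟨j, hj, e⟩ := hs (N - 1) (by omega)
    by_cases hji : j = i
    · rw [← hji]; exact e
    · have := h j hj hji; omega

theorem rank_of_ext' {X : ℕ → ℕ} {N i c : ℕ} (hN : 2 ≤ N) (hi : i < N) (hX : ∀ j, j < N → X j < N)
    (hs : ∀ v, v < N → ∃ j, j < N ∧ X j = v) (s : Bool)
    (h : ∀ j, j < N → j ≠ i → j ≠ c → sl s (X j) (X i)) :
    X i = 0 ∨ X i = 1 ∨ X i = N - 2 ∨ X i = N - 1 := by
  have := hX i hi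
  by_contra hcon
  push Not at hcon
  obtain ⟨c1, c2, c3, c4⟩ := hcon
  cases s <;> simp only [sl, Bool.false_eq_true, if_false, if_true] at h
  · obtain ⟨j, hj, e⟩ := hs 0 (by omega)
    obtain ⟨k, hk, e'⟩ := hs 1 (by omega)
    have h1 : j ≠ i := by rintro rfl; omega
    have h2 : k ≠ i := by rintro rfl; omega
    have h3 : j = c := by
      by_contra hh; have := h j hj h1 hh; omega
    have h4 : k = c := by
      by_contra hh; have := h k hk h2 hh; omega
    rw [h3] at e
    rw [h4] at e'
    omega
  · obtain ⟨j, hj, e⟩ := hs (N - 1) (by omega)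
    obtain ⟨k, hk, e'⟩ := hs (N - 2) (by omega)
    have h1 : j ≠ i := by rintro rfl; omega
    have h2 : k ≠ i := by rintro rfl; omega
    have h3 : j = c := by
      by_contra hh; have := h j hj h1 hh; omega
    have h4 : k = c := by
      by_contra hh; have := h k hk h2 hh; omega
    rw [h3] at e
    rw [h4] at e'
    omega

theorem exists_pos {p : CPerm} {n : ℕ} (hv : p.IsValid) (hH : H p) (hn : 1 ≤ n)
    (hl : p.vals.length = n + 1) :
    ∃ i, i < n + 1 ∧ i ≠ p.origin ∧ (i, p.valAt i) ∈ positions n := by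
  obtain ⟨r, r1, r2⟩ := hH
  rw [hl] at r1 r2
  have ho : p.origin < n + 1 := hl ▸ hv.2.1
  obtain ⟨i, hi, hmax⟩ := Finset.exists_max_image (Finset.range (n + 1)) r ⟨0, by simp⟩
  rw [Finset.mem_range] at hi
  have hmax' : ∀ j, j < n + 1 → j ≠ i → r j < r i := by
    intro j hj hji
    refine lt_of_le_of_ne (hmax j (Finset.mem_range.2 hj)) ?_
    intro e
    exact hji (r1 j i hj hi e)
  have hio : i ≠ p.origin := by
    intro e
    obtain ⟨k, hk, hki⟩ : ∃ k, k < n + 1 ∧ k ≠ i := by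
      by_cases h : i = 0
      · exact ⟨1, by omega, by omega⟩
      · exact ⟨0, by omega, by omega⟩
    have h1 := hmax' k hk hki
    have h2 := (r2 k hk (by omega)).1
    rw [← e] at h2
    omega
  refine ⟨i, hi, hio, ?_⟩
  have hVlt : ∀ j, j < n + 1 → p.valAt j < n + 1 := fun j hj => hl ▸ valid_lt hv (hl ▸ hj)
  have hVs : ∀ v, v < n + 1 → ∃ j, j < n + 1 ∧ p.valAt j = v := by
    intro v hv'
    have := valid_surj hv (v := v) (by omega)
    rwa [hl] at this
  have hIs : ∀ v, v < n + 1 → ∃ j, j < n + 1 ∧ (fun k : ℕ => k) j = v := fun v hv => ⟨v, hv, rfl⟩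
  rcases (r2 i hi hio).2 with ⟨c, _, s, t, h⟩ | ⟨c, _, s, t, h⟩
  · have h1 := rank_of_ext (X := fun k : ℕ => k) hi (fun j hj => hj) hIs s
      (fun j hj hji => (h j ⟨hj, hmax' j hj hji⟩).1)
    have h2 := rank_of_ext' (c := c) (by omega) hi hVlt hVs t
      (fun j hj hji hjc => (h j ⟨hj, hmax' j hj hji⟩).2 hjc)
    have e : n + 1 - 2 = n - 1 := by omega
    rw [e] at h2
    simp only [Nat.add_sub_cancel] at h1 h2
    rcases h1 with h1 | h1 <;> rcases h2 with h2 | h2 | h2 | h2 <;> rw [h2, h1] <;>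
      simp [positions]
  · have h1 := rank_of_ext hi hVlt hVs s
      (fun j hj hji => (h j ⟨hj, hmax' j hj hji⟩).1)
    have h2 := rank_of_ext' (X := fun k : ℕ => k) (c := c) (by omega) hi (fun j hj => hj) hIs t
      (fun j hj hji hjc => (h j ⟨hj, hmax' j hj hji⟩).2 hjc)
    have e : n + 1 - 2 = n - 1 := by omega
    rw [e] at h2
    simp only [Nat.add_sub_cancel] at h1 h2
    rcases h1 with h1 | h1 <;> rcases h2 with h2 | h2 | h2 | h2 <;> rw [h1, h2] <;>
      simp [positions]

/-- Delete the point with index `i`. -/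
def del (i : ℕ) (p : CPerm) : CPerm :=
  ⟨(List.range (p.vals.length - 1)).map (fun k =>
      let u := p.valAt (if k < i then k else k + 1)
      if p.valAt i < u then u - 1 else u),
    if p.origin < i then p.origin else p.origin - 1⟩

/-- Insert a point at index `x.1` with value `x.2`. -/
def ins (x : ℕ × ℕ) (p : CPerm) : CPerm :=
  ⟨(List.range (p.vals.length + 1)).map (fun k =>
      if k = x.1 then x.2 else
      let u := p.valAt (if k < x.1 then k else k - 1)
      if x.2 ≤ u then u + 1 else u),
    if p.origin < x.1 then p.origin else p.origin + 1⟩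

theorem del_length (i : ℕ) (p : CPerm) : (del i p).vals.length = p.vals.length - 1 := by
  simp [del]

theorem del_valAt (i : ℕ) (p : CPerm) {k : ℕ} (hk : k < p.vals.length - 1) :
    (del i p).valAt k = if p.valAt i < p.valAt (if k < i then k else k + 1)
      then p.valAt (if k < i then k else k + 1) - 1 else p.valAt (if k < i then k else k + 1) := by
  simp [del, CPerm.valAt, List.getD_eq_getElem?_getD, hk]

theorem ins_del {p : CPerm} (hv : p.IsValid) {i : ℕ} (hi : i < p.vals.length)
    (hio : i ≠ p.origin) : ins (i, p.valAt i) (del i p) = p := by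
  have ho := hv.2.1
  have hvals : (ins (i, p.valAt i) (del i p)).vals = p.vals := by
    apply List.ext_getElem
    · simp only [ins, List.length_map, List.length_range, del_length]
      omega
    · intro k h1 h2
      have e : p.vals[k] = p.valAt k := by
        simp [CPerm.valAt, List.getD_eq_getElem?_getD, h2]
      rw [e]
      simp only [ins, List.getElem_map, List.getElem_range]
      by_cases hk : k = i
      · simp [hk]
      · have hne : p.valAt k ≠ p.valAt i := fun e => hk (valid_inj hv h2 hi e)
        by_cases hlt : k < i
        · simp only [hk, if_false, hlt, if_true]
          rw [del_valAt i p (by omega)]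
          simp only [hlt, if_true]
          split_ifs <;> omega
        · simp only [hk, if_false, hlt]
          rw [del_valAt i p (by omega)]
          have e1 : ¬ (k - 1 < i) := by omega
          have e2 : k - 1 + 1 = k := by omega
          simp only [e1, if_false, e2]
          split_ifs <;> omega
  have horig : (ins (i, p.valAt i) (del i p)).origin = p.origin := by
    simp only [ins, del]
    split_ifs <;> omega
  cases p
  cases h : ins _ _
  rw [h] at hvals horig
  simp only at hvals horig
  rw [hvals, horig]

theorem del_patternLE {p : CPerm} (hv : p.IsValid) {i : ℕ} (hi : i < p.vals.length)
    (hio : i ≠ p.origin) : CPerm.PatternLE (del i p) p := by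
  have ho := hv.2.1
  refine ⟨fun k => if k < i then k else k + 1, ?_, ?_, ?_, ?_⟩
  · intro a b _ _ h
    simp only
    split_ifs <;> omega
  · rw [del_length]
    intro a ha
    simp only
    split_ifs <;> omega
  · simp only [del]
    split_ifs <;> omega
  · rw [del_length]
    intro a b ha hb
    rw [del_valAt i p ha, del_valAt i p hb]
    have n1 : p.valAt (if a < i then a else a + 1) ≠ p.valAt i := fun e => by
      have := valid_inj hv (by split_ifs <;> omega) hi e
      split_ifs at this <;> omega
    have n2 : p.valAt (if b < i then b else b + 1) ≠ p.valAt i := fun e => by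
      have := valid_inj hv (by split_ifs <;> omega) hi e
      split_ifs at this <;> omega
    simp only
    generalize p.valAt (if a < i then a else a + 1) = u at *
    generalize p.valAt (if b < i then b else b + 1) = w at *
    split_ifs <;> omega

theorem del_valid {p : CPerm} (hv : p.IsValid) {i : ℕ} (hi : i < p.vals.length)
    (hio : i ≠ p.origin) : (del i p).IsValid := by
  have ho := hv.2.1
  have hlen := del_length i p
  refine ⟨?_, ?_, ?_⟩
  · intro e
    rw [e] at hlen
    simp at hlen
    omega
  · rw [hlen]
    simp only [del]
    split_ifs <;> omega
  · have val : ∀ k, k < p.vals.length - 1 →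
        p.valAt (if k < i then k else k + 1) ≠ p.valAt i ∧
        p.valAt (if k < i then k else k + 1) < p.vals.length := by
      intro k hk
      refine ⟨fun e => ?_, valid_lt hv (by split_ifs <;> omega)⟩
      have := valid_inj hv (by split_ifs <;> omega) hi e
      split_ifs at this <;> omega
    have hvi := valid_lt hv hi
    have nd : (del i p).vals.Nodup := by
      refine List.Nodup.map_on ?_ List.nodup_range
      intro a ha b hb e
      rw [List.mem_range] at ha hb
      have h1 := val a ha
      have h2 := val b hb
      simp only at e
      have e' : p.valAt (if a < i then a else a + 1) = p.valAt (if b < i then b else b + 1) := by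
        generalize p.valAt (if a < i then a else a + 1) = u at *
        generalize p.valAt (if b < i then b else b + 1) = w at *
        split_ifs at e <;> omega
      have := valid_inj hv (by split_ifs <;> omega) (by split_ifs <;> omega) e'
      split_ifs at this <;> omega
    have sub : (del i p).vals ⊆ List.range (del i p).vals.length := by
      intro x hx
      rw [hlen, List.mem_range]
      obtain ⟨a, ha, rfl⟩ := List.mem_map.1 hx
      rw [List.mem_range] at ha
      have h1 := val a ha
      simp only
      generalize p.valAt (if a < i then a else a + 1) = u at *
      split_ifs <;> omega
    exact (List.subperm_of_subset nd sub).perm_of_length_le (by simp)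

theorem finite_valid (n : ℕ) : {p : CPerm | p.IsValid ∧ p.len = n}.Finite := by
  have hf : (((List.range (n + 1)).permutations.toFinset : Set (List ℕ)) ×ˢ
      (Finset.range (n + 1) : Set ℕ)).Finite := (Finset.finite_toSet _).prod (Finset.finite_toSet _)
  refine (hf.image (fun x => (⟨x.1, x.2⟩ : CPerm))).subset ?_
  rintro p ⟨hv, hl⟩
  have h0 := hv.2.1
  have hl' : p.vals.length = n + 1 := by
    unfold CPerm.len at hl
    omega
  refine ⟨(p.vals, p.origin), ⟨?_, ?_⟩, rfl⟩
  · have := hv.2.2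
    rw [hl'] at this
    simpa using this
  · simp; omega

end PinRatio

/-- Any subclass of the complete pin class satisfies
`C_n ≤ 12·C_{n−1}` for all `n ≥ 1`. -/
theorem pin_subclass_ratio_bound (S : Set CPerm) (hS : CPerm.IsClass S)
    (hsub : S ⊆ CompletePinClass) :
    ∀ n : ℕ, 1 ≤ n → CPerm.count S n ≤ 12 * CPerm.count S (n - 1) := by
  intro n hn
  obtain ⟨_, hval, hdown⟩ := hS
  unfold CPerm.count
  set A := {p | p ∈ S ∧ p.len = n - 1} with hA
  have hAfin : A.Finite :=
    (PinRatio.finite_valid (n - 1)).subset (fun p hp => ⟨hval p hp.1, hp.2⟩)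
  set T : Set (ℕ × ℕ) := ((PinRatio.positions n).toFinset : Set (ℕ × ℕ)) with hT
  have hTc : T.ncard ≤ 12 := by
    rw [hT, Set.ncard_coe_finset]
    exact (List.toFinset_card_le _).trans (by simp [PinRatio.positions])
  have hTfin : T.Finite := Finset.finite_toSet _
  have hsubset : {p | p ∈ S ∧ p.len = n} ⊆ (fun x => PinRatio.ins x.1 x.2) '' (T ×ˢ A) := by
    rintro p ⟨hp, hl⟩
    have hv := hval p hp
    have h0 := hv.2.1
    have hl' : p.vals.length = n + 1 := by
      unfold CPerm.len at hl
      omega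
    obtain ⟨i, hi, hio, hpos⟩ := PinRatio.exists_pos hv (PinRatio.H_of_mem (hsub hp)) hn hl'
    have hi' : i < p.vals.length := by omega
    refine ⟨((i, p.valAt i), PinRatio.del i p), ⟨?_, ?_, ?_⟩, PinRatio.ins_del hv hi' hio⟩
    · simpa [hT] using hpos
    · exact hdown _ _ hp (PinRatio.del_valid hv hi' hio) (PinRatio.del_patternLE hv hi' hio)
    · simp only [CPerm.len, PinRatio.del_length]
      omega
  calc _ ≤ _ := Set.ncard_le_ncard hsubset ((hTfin.prod hAfin).image _)
    _ ≤ (T ×ˢ A).ncard := Set.ncard_image_le (hTfin.prod hAfin)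
    _ = T.ncard * A.ncard := Set.ncard_prod
    _ ≤ 12 * A.ncard := Nat.mul_le_mul_right _ hTc
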